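/- Let X be a set and let σ and τ be topologies on X such that τ = σ^d (i.e., τ arises as a dual topology). Then τ^{ddd} = τ^d; that is, every topology arising as a dual belongs to the class G_3. -/

import Mathlib

/-- A set is *saturated* in a topological space if it is an intersection of open sets. -/
def IsSaturatedSet {X : Type*} (t : TopologicalSpace X) (A : Set X) : Prop :=
  ∃ S : Set (Set X), (∀ U ∈ S, t.IsOpen U) ∧ A = ⋂₀ S

/-- The de Groot dual of a topology: the topology generated by taking the compact
saturated sets as a closed base (equivalently, their complements as an open subbase). -/
def deGrootDual {X : Type*} (t : TopologicalSpace X) : TopologicalSpace X :=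
  TopologicalSpace.generateFrom
    {U : Set X | ∃ K : Set X, @IsCompact X t K ∧ IsSaturatedSet t K ∧ U = Kᶜ}

section DualHelpers

open Set Filter Topology

/-- The specialization preorder, phrased through open sets. -/
def dgLe {X : Type*} (t : TopologicalSpace X) (x y : X) : Prop :=
  ∀ U : Set X, IsOpen[t] U → x ∈ U → y ∈ U

theorem dgLe_refl {X : Type*} (t : TopologicalSpace X) (x : X) : dgLe t x x :=
  fun _ _ h => h

theorem dgLe_trans {X : Type*} {t : TopologicalSpace X} {x y z : X}
    (h : dgLe t x y) (h' : dgLe t y z) : dgLe t x z :=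
  fun U hU hx => h' U hU (h U hU hx)

theorem sat_iff {X : Type*} (t : TopologicalSpace X) (A : Set X) :
    IsSaturatedSet t A ↔ ∀ x ∈ A, ∀ y, dgLe t x y → y ∈ A := by
  constructor
  · rintro ⟨S, hS, rfl⟩ x hx y hxy U hU
    exact hxy U (hS U hU) (hx U hU)
  · intro h
    refine ⟨{U | ∃ y, y ∉ A ∧ IsOpen[t] U ∧ A ⊆ U ∧ y ∉ U}, fun U hU => ?_, ?_⟩
    · obtain ⟨y, -, hU, -⟩ := hU
      exact hU
    · apply Subset.antisymm
      · rintro x hx U ⟨y, -, -, hAU, -⟩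
        exact hAU hx
      · intro y hy
        by_contra hyA
        have h1 : ∀ x : A, ∃ U, IsOpen[t] U ∧ (x : X) ∈ U ∧ y ∉ U := by
          intro x
          by_contra hne
          push Not at hne
          exact hyA (h x x.2 y hne)
        choose U hU hxU hyU using h1
        have h2 : y ∉ ⋃ x, U x := by simpa using fun a ha => hyU ⟨a, ha⟩
        exact h2 (hy _ ⟨y, hyA, isOpen_iUnion hU,
          fun x hx => mem_iUnion.2 ⟨⟨x, hx⟩, hxU ⟨x, hx⟩⟩, h2⟩)

/-- Saturation of a set. -/
def dgUp {X : Type*} (t : TopologicalSpace X) (C : Set X) : Set X :=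
  {y | ∃ x ∈ C, dgLe t x y}

theorem subset_dgUp {X : Type*} (t : TopologicalSpace X) (C : Set X) : C ⊆ dgUp t C :=
  fun x hx => ⟨x, hx, dgLe_refl t x⟩

theorem sat_dgUp {X : Type*} (t : TopologicalSpace X) (C : Set X) :
    IsSaturatedSet t (dgUp t C) := by
  rw [sat_iff]
  rintro x ⟨z, hz, hzx⟩ y hxy
  exact ⟨z, hz, dgLe_trans hzx hxy⟩

theorem compact_dgUp {X : Type*} (t : TopologicalSpace X) {C : Set X} (hC : IsCompact C) :
    IsCompact (dgUp t C) := by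
  refine isCompact_of_finite_subcover fun {ι} U hU hcov => ?_
  obtain ⟨s, hs⟩ := hC.elim_finite_subcover U hU ((subset_dgUp t C).trans hcov)
  refine ⟨s, ?_⟩
  rintro y ⟨x, hx, hxy⟩
  exact hxy _ (isOpen_biUnion fun i _ => hU i) (hs hx)

theorem closed_down {X : Type*} (t : TopologicalSpace X) (y : X) :
    IsClosed {x | dgLe t x y} := by
  have : {x | dgLe t x y} = closure {y} := by
    ext x
    rw [mem_closure_iff]
    constructor
    · intro h U hU hx
      exact ⟨y, h U hU hx, rfl⟩
    · rintro h U hU hx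
      obtain ⟨z, hz, rfl⟩ := h U hU hx
      exact hz
  rw [this]
  exact isClosed_closure

theorem open_dual_compl {X : Type*} (t : TopologicalSpace X) {K : Set X}
    (hK : IsCompact K) (hs : IsSaturatedSet t K) : IsOpen[deGrootDual t] Kᶜ :=
  TopologicalSpace.isOpen_generateFrom_of_mem ⟨K, hK, hs, rfl⟩

theorem dgLe_dual {X : Type*} (t : TopologicalSpace X) (x y : X) :
    dgLe (deGrootDual t) x y ↔ dgLe t y x := by
  constructor
  · intro h
    by_contra hne
    have h1 := open_dual_compl t (compact_dgUp t (isCompact_singleton (x := y)))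
      (sat_dgUp t {y})
    have h2 := h _ h1 (by rintro ⟨z, rfl, hz⟩; exact hne hz)
    exact h2 (subset_dgUp t _ rfl)
  · intro h U hU
    induction hU with
    | basic U hU =>
      obtain ⟨K, -, hs, rfl⟩ := hU
      exact fun hx hy => hx ((sat_iff t K).1 hs y hy x h)
    | univ => exact fun _ => trivial
    | inter U V _ _ h1 h2 => exact fun hx => ⟨h1 hx.1, h2 hx.2⟩
    | sUnion S _ ih =>
      rintro ⟨U, hU, hx⟩
      exact ⟨U, hU, ih U hU hx⟩

theorem sat_dual_dual {X : Type*} (t : TopologicalSpace X) (A : Set X) :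
    IsSaturatedSet (deGrootDual (deGrootDual t)) A ↔ IsSaturatedSet t A := by
  simp only [sat_iff, dgLe_dual]

/-- A dual-compact member of an ultrafilter contains a dual limit. -/
theorem exists_dual_lim {X : Type*} (t : TopologicalSpace X) {M : Set X}
    (hM : @IsCompact X (deGrootDual t) M) (V : Ultrafilter X) (hV : M ∈ V) :
    ∃ y ∈ M, ∀ C : Set X, IsCompact C → C ∈ V → ∃ x ∈ C, dgLe t x y := by
  obtain ⟨y, hy, hle⟩ := (@isCompact_iff_ultrafilter_le_nhds' X (deGrootDual t) M).1 hM V hV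
  refine ⟨y, hy, fun C hC hCV => ?_⟩
  by_contra hne
  have h1 : (dgUp t C)ᶜ ∈ V := hle
    (@IsOpen.mem_nhds X (deGrootDual t) y (dgUp t C)ᶜ
      (open_dual_compl t (compact_dgUp t hC) (sat_dgUp t C)) hne)
  have h2 : dgUp t C ∈ V := mem_of_superset hCV (subset_dgUp t C)
  exact (Ultrafilter.compl_mem_iff_notMem.1 h1) h2

theorem down_of_dual_sat {X : Type*} {t : TopologicalSpace X} {M : Set X}
    (hM : IsSaturatedSet (deGrootDual t) M) {x y : X} (hy : y ∈ M) (h : dgLe t x y) : x ∈ M :=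
  (sat_iff _ M).1 hM y hy x ((dgLe_dual t y x).2 h)

theorem compact_inter_dual {X : Type*} (t : TopologicalSpace X) {C M : Set X}
    (hC : IsCompact C) (hM : @IsCompact X (deGrootDual t) M)
    (hMs : IsSaturatedSet (deGrootDual t) M) : IsCompact (C ∩ M) := by
  rw [isCompact_iff_ultrafilter_le_nhds']
  intro V hV
  have hCV : C ∈ V := mem_of_superset hV inter_subset_left
  obtain ⟨y, hyM, hy⟩ := exists_dual_lim t hM V (mem_of_superset hV inter_subset_right)
  suffices h : ∃ x ∈ C ∩ {x | dgLe t x y}, ↑V ≤ 𝓝 x by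
    obtain ⟨x, ⟨hxC, hxy⟩, hx⟩ := h
    exact ⟨x, ⟨hxC, down_of_dual_sat hMs hyM hxy⟩, hx⟩
  by_contra hne
  push Not at hne
  have hK : IsCompact (C ∩ {x | dgLe t x y}) := hC.inter_right (closed_down t y)
  have key : ∃ U, IsOpen U ∧ C ∩ {x | dgLe t x y} ⊆ U ∧ U ∉ V := by
    refine hK.induction_on (p := fun s => ∃ U, IsOpen U ∧ s ⊆ U ∧ U ∉ V) ?_ ?_ ?_ ?_
    · exact ⟨∅, isOpen_empty, Subset.rfl, V.empty_notMem⟩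
    · rintro s s' hss ⟨U, hU, hs, hUV⟩
      exact ⟨U, hU, hss.trans hs, hUV⟩
    · rintro s s' ⟨U, hU, hs, hUV⟩ ⟨U', hU', hs', hUV'⟩
      refine ⟨U ∪ U', hU.union hU', union_subset_union hs hs', ?_⟩
      rw [Ultrafilter.union_mem_iff]
      tauto
    · intro x hx
      have h1 := hne x hx
      rw [(nhds_basis_opens x).ge_iff] at h1
      push Not at h1
      obtain ⟨U, ⟨hxU, hU⟩, hUV⟩ := h1
      exact ⟨U, mem_nhdsWithin_of_mem_nhds (hU.mem_nhds hxU), U, hU, Subset.rfl, hUV⟩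
  obtain ⟨U, hU, hsub, hUV⟩ := key
  obtain ⟨x, ⟨hxC, hxU⟩, hxy⟩ := hy (C ∩ Uᶜ) (hC.inter_right hU.isClosed_compl)
    (inter_mem hCV (Ultrafilter.compl_mem_iff_notMem.2 hUV))
  exact hxU (hsub ⟨hxC, hxy⟩)

theorem compact_inter_finite {X : Type*} (t : TopologicalSpace X) {C : Set X}
    (hC : IsCompact C) {F : Set (Set X)} (hF : F.Finite)
    (h : ∀ M ∈ F, @IsCompact X (deGrootDual t) M ∧ IsSaturatedSet (deGrootDual t) M) :
    IsCompact (C ∩ ⋂₀ F) := by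
  induction F, hF using Set.Finite.induction_on with
  | empty => simpa using hC
  | @insert M F _ _ ih =>
    have h1 := ih fun M' hM' => h M' (mem_insert_of_mem _ hM')
    have h2 := h M (mem_insert _ _)
    have h3 := compact_inter_dual t h1 h2.1 h2.2
    rwa [sInter_insert, inter_comm M, ← inter_assoc]

theorem fip_main {X : Type*} (t : TopologicalSpace X) {L : Set X} (hL : IsCompact L)
    {S : Set (Set X)}
    (hS : ∀ M ∈ S, @IsCompact X (deGrootDual t) M ∧ IsSaturatedSet (deGrootDual t) M)
    (fip : ∀ F ⊆ S, F.Finite → (L ∩ ⋂₀ F).Nonempty) : (L ∩ ⋂₀ S).Nonempty := by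
  have hcpt : ∀ F ⊆ S, F.Finite → IsCompact (L ∩ ⋂₀ F) := fun F hFS hF =>
    compact_inter_finite t hL hF fun M hM => hS M (hFS hM)
  let Z : Set (Set X) := {A | IsClosed A ∧ ∀ F ⊆ S, F.Finite → ((L ∩ ⋂₀ F) ∩ A).Nonempty}
  have huniv : univ ∈ Z := ⟨isClosed_univ, fun F h1 h2 => by simpa using fip F h1 h2⟩
  obtain ⟨A, hA⟩ : ∃ m, Minimal (· ∈ Z) m := by
    refine zorn_superset Z fun c hc hchain => ⟨⋂₀ c, ⟨isClosed_sInter fun B hB => (hc hB).1,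
      fun F hFS hF => ?_⟩, fun s hs => sInter_subset_of_mem hs⟩
    refine (hcpt F hFS hF).nonempty_inter_sInter (fun B hB => (hc hB).1) fun a hac ha => ?_
    have : ∃ B, (B = univ ∨ B ∈ c) ∧ B ⊆ ⋂₀ a := by
      induction a, ha using Set.Finite.induction_on with
      | empty => exact ⟨univ, Or.inl rfl, by simp⟩
      | @insert D a _ _ ih =>
        obtain ⟨B, hB, hBa⟩ := ih ((subset_insert _ _).trans hac)
        have hD : D ∈ c := hac (mem_insert _ _)
        rw [sInter_insert]
        have hcmp : B ⊆ D ∨ D ⊆ B := by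
          rcases hB with rfl | hB
          · exact Or.inr (subset_univ _)
          · exact hchain.total hB hD
        rcases hcmp with h | h
        · exact ⟨B, hB, subset_inter h hBa⟩
        · exact ⟨D, Or.inr hD, subset_inter Subset.rfl (h.trans hBa)⟩
    obtain ⟨B, hB, hBa⟩ := this
    have hBZ : B ∈ Z := by
      rcases hB with rfl | hB
      · exact huniv
      · exact hc hB
    exact (hBZ.2 F hFS hF).mono (inter_subset_inter_right _ hBa)
  have hAZ : A ∈ Z := hA.prop
  obtain ⟨W, hW⟩ := Ultrafilter.exists_ultrafilter_of_finite_inter_nonempty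
    (insert (L ∩ A) S) (by
      intro T hT
      obtain ⟨x, ⟨hxL, hxF⟩, hxA⟩ := hAZ.2 ((T : Set (Set X)) ∩ S) inter_subset_right
        (T.finite_toSet.subset inter_subset_left)
      refine ⟨x, fun B hB => ?_⟩
      rcases hT hB with rfl | hBS
      · exact ⟨hxL, hxA⟩
      · exact hxF B ⟨hB, hBS⟩)
  have hLA : L ∩ A ∈ W := hW (mem_insert _ _)
  have hAM : ∀ M ∈ S, A ⊆ M := by
    intro M hM
    obtain ⟨y, hyM, hy⟩ := exists_dual_lim t (hS M hM).1 W (hW (mem_insert_of_mem _ hM))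
    have hZ' : A ∩ {x | dgLe t x y} ∈ Z := by
      refine ⟨hAZ.1.inter (closed_down t y), fun F hFS hF => ?_⟩
      have hFW : ⋂₀ F ∈ W := (sInter_mem hF).2 fun B hB => hW (mem_insert_of_mem _ (hFS hB))
      obtain ⟨x, ⟨hx, hxA⟩, hxy⟩ := hy ((L ∩ ⋂₀ F) ∩ A) ((hcpt F hFS hF).inter_right hAZ.1)
        (mem_of_superset (inter_mem hLA hFW) fun z hz => ⟨⟨hz.1.1, hz.2⟩, hz.1.2⟩)
      exact ⟨x, hx, hxA, hxy⟩
    intro x hx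
    exact down_of_dual_sat (hS M hM).2 hyM (hA.le_of_le hZ' inter_subset_left hx).2
  obtain ⟨x, ⟨hxL, -⟩, hxA⟩ := hAZ.2 ∅ (empty_subset _) finite_empty
  exact ⟨x, hxL, fun M hM => hAM M hM hxA⟩

theorem compact_dual_dual {X : Type*} (t : TopologicalSpace X) {L : Set X} (hL : IsCompact L) :
    @IsCompact X (deGrootDual (deGrootDual t)) L := by
  refine @isCompact_generateFrom X (deGrootDual (deGrootDual t)) _ rfl L fun P hP hcov => ?_
  by_contra hne
  push Not at hne
  have := fip_main t hL (S := compl '' P) (by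
      rintro _ ⟨U, hU, rfl⟩
      obtain ⟨K, hK, hKs, rfl⟩ := hP hU
      rw [compl_compl]
      exact ⟨hK, hKs⟩) (by
      intro F hFS hF
      have h1 := hne (compl '' F) (by
        rintro _ ⟨B, hB, rfl⟩
        obtain ⟨U, hU, rfl⟩ := hFS hB
        rwa [compl_compl]) (hF.image _)
      obtain ⟨x, hx, hxn⟩ := not_subset.1 h1
      refine ⟨x, hx, fun B hB => ?_⟩
      by_contra hxB
      exact hxn ⟨Bᶜ, ⟨B, hB, rfl⟩, hxB⟩)
  obtain ⟨x, hxL, hx⟩ := this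
  obtain ⟨U, hU, hxU⟩ := hcov hxL
  exact hx Uᶜ ⟨U, hU, rfl⟩ hxU

/-- The triple dual is finer than the dual. -/
theorem triple_le {X : Type*} (t : TopologicalSpace X) :
    deGrootDual (deGrootDual (deGrootDual t)) ≤ deGrootDual t := by
  apply TopologicalSpace.generateFrom_anti
  rintro U ⟨K, hK, hs, rfl⟩
  exact ⟨K, compact_dual_dual t hK, (sat_dual_dual t K).2 hs, rfl⟩

theorem compact_of_le {X : Type*} {t t' : TopologicalSpace X} (h : t ≤ t') {K : Set X}
    (hK : @IsCompact X t K) : @IsCompact X t' K := by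
  have := @IsCompact.image X X t t' K id hK (continuous_id_of_le h)
  simpa using this

end DualHelpers

/-- Corollary 3.7 (first part): a topology arising as a dual belongs to G_3,
i.e. if τ = σ^d then τ^{ddd} = τ^d. -/
theorem dual_topology_mem_G3 {X : Type*} (σ τ : TopologicalSpace X)
    (h : τ = deGrootDual σ) :
    deGrootDual (deGrootDual (deGrootDual τ)) = deGrootDual τ := by
  subst h
  apply le_antisymm (triple_le _)
  apply TopologicalSpace.generateFrom_anti
  rintro U ⟨K, hK, hs, rfl⟩
  exact ⟨K, compact_of_le (triple_le σ) hK, (sat_dual_dual _ K).1 hs, rfl⟩
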